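/- For all integers m, n ≥ 1, every triangulation of the m×n rectangular polyomino is word-representable if and only if it is 3-colourable. -/

import Mathlib

/-- Two distinct letters `x` and `y` alternate in the word `w` if, after deleting all
letters other than `x` and `y` from `w`, no two consecutive letters of the resulting
word are equal (i.e. it reads `xyxy...` or `yxyx...`). -/
def Alternates {V : Type*} [DecidableEq V] (w : List V) (x y : V) : Prop :=
  List.Chain' (· ≠ ·) (w.filter fun z => z = x ∨ z = y)

/-- A finite simple graph `G = (V, E)` is word-representable if there is a word over the
alphabet `V` in which every element of `V` occurs at least once and such that, for all
distinct `x, y ∈ V`, the letters `x` and `y` alternate in the word iff `{x, y} ∈ E`. -/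
def WordRepresentable {V : Type*} [DecidableEq V] (G : SimpleGraph V) : Prop :=
  ∃ w : List V, (∀ v : V, v ∈ w) ∧
    ∀ x y : V, x ≠ y → (G.Adj x y ↔ Alternates w x y)

/-- The vertices of the `m × n` rectangular polyomino: the lattice points `(x, y)` with
`0 ≤ x ≤ m` and `0 ≤ y ≤ n`. -/
abbrev GridV (m n : ℕ) := {p : ℕ × ℕ // p.1 ≤ m ∧ p.2 ≤ n}

/-- A triangulation of the `m × n` rectangular polyomino: all unit-length horizontal and
vertical grid edges, together with, for each unit cell `[i, i+1] × [j, j+1]`, exactly one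
of its two diagonals — the diagonal `{(i,j), (i+1,j+1)}` if `diag i j = true`, and the
diagonal `{(i+1,j), (i,j+1)}` otherwise — and no other edges.  As `diag` ranges over all
functions, this produces exactly the triangulations of the `m × n` rectangular polyomino. -/
def gridTriangulation (m n : ℕ) (diag : ℕ → ℕ → Bool) : SimpleGraph (GridV m n) :=
  SimpleGraph.fromRel fun u v =>
    -- horizontal grid edges
    (v.1.1 = u.1.1 + 1 ∧ v.1.2 = u.1.2) ∨
    -- vertical grid edges
    (v.1.1 = u.1.1 ∧ v.1.2 = u.1.2 + 1) ∨
    -- the chosen diagonal of each unit cell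
    (diag u.1.1 u.1.2 = true ∧ v.1.1 = u.1.1 + 1 ∧ v.1.2 = u.1.2 + 1) ∨
    (∃ i j, diag i j = false ∧ u.1.1 = i + 1 ∧ u.1.2 = j ∧ v.1.1 = i ∧ v.1.2 = j + 1)

set_option linter.unusedSimpArgs false

theorem alt_aux {V : Type*} [DecidableEq V] (w : List V) : ∀ (x y : V), x ≠ y →
    (List.IsChain (· ≠ ·) (x :: w.filter fun z => z = x ∨ z = y) ↔
      ∀ t, (w.take t).count x ≤ (w.take t).count y ∧
        (w.take t).count y ≤ (w.take t).count x + 1) := by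
  induction w with
  | nil => intro x y h; simp
  | cons a w ih =>
    intro x y h
    by_cases hx : a = x
    · subst hx
      simp only [List.filter_cons]
      simp
      refine ⟨1, ?_⟩
      simp [h]
    · by_cases hy : a = y
      · subst hy
        have := ih a x hx
        have e : (w.filter fun z => z = x ∨ z = a) = w.filter fun z => z = a ∨ z = x := by
          congr 1; funext z; simp [or_comm]
        simp only [List.filter_cons]
        simp only [or_true, decide_true, if_true, List.isChain_cons_cons, e, this]
        constructor
        · rintro ⟨-, h2⟩ t
          cases t with
          | zero => simp
          | succ t =>
            have := h2 t
            simp [hx]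
            omega
        · intro h2
          refine ⟨h, fun t => ?_⟩
          have := h2 (t+1)
          simp [hx] at this
          omega
      · have := ih x y h
        simp only [List.filter_cons]
        simp only [hx, hy, or_false, decide_false, Bool.false_eq_true, if_false, this]
        constructor
        · intro h2 t
          cases t with
          | zero => simp
          | succ t =>
            have := h2 t
            simp [hx, hy]
            omega
        · intro h2 t
          have := h2 (t+1)
          simp [hx, hy] at this
          omega

theorem alternates_comm {V : Type*} [DecidableEq V] (w : List V) (x y : V) :
    Alternates w x y ↔ Alternates w y x := by
  have e : (w.filter fun z => z = x ∨ z = y) = w.filter fun z => z = y ∨ z = x := by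
    congr 1; funext z; simp [or_comm]
  unfold Alternates
  rw [e]

theorem alternates_iff {V : Type*} [DecidableEq V] (w : List V) (x y : V) (h : x ≠ y) :
    Alternates w x y ↔
      (∀ t, (w.take t).count x ≤ (w.take t).count y ∧
        (w.take t).count y ≤ (w.take t).count x + 1) ∨
      (∀ t, (w.take t).count y ≤ (w.take t).count x ∧
        (w.take t).count x ≤ (w.take t).count y + 1) := by
  rw [← alt_aux w x y h, ← alt_aux w y x h.symm]
  have e : (w.filter fun z => z = y ∨ z = x) = w.filter fun z => z = x ∨ z = y := by
    congr 1; funext z; simp [or_comm]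
  rw [e]
  have hm : ∀ z ∈ (w.filter fun z => z = x ∨ z = y), z = x ∨ z = y := by
    intro z hz; simpa using (List.mem_filter.1 hz).2
  change List.IsChain _ _ ↔ _
  revert hm
  generalize (w.filter fun z => z = x ∨ z = y) = F
  intro hm
  cases F with
  | nil => simp
  | cons a F =>
    simp only [List.isChain_cons_cons]
    have := hm a (by simp)
    rcases this with rfl | rfl
    · simp [h.symm]
    · simp [h]

theorem nbhd_comparability {V : Type*} [DecidableEq V] (G : SimpleGraph V)
    (hG : WordRepresentable G) (h : V) :
    ∃ e : V → ℕ → ℤ, ∀ x y, G.Adj h x → G.Adj h y → x ≠ y →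
      (G.Adj x y ↔ e x ≤ e y ∨ e y ≤ e x) := by
  obtain ⟨w, -, hw⟩ := hG
  let c : V → ℕ → ℤ := fun x t => (w.take t).count x
  have c0 : ∀ x, c x 0 = 0 := by intro x; simp [c]
  have alt : ∀ x y, x ≠ y → (G.Adj x y ↔ (∀ t, c x t ≤ c y t ∧ c y t ≤ c x t + 1) ∨
      (∀ t, c y t ≤ c x t ∧ c x t ≤ c y t + 1)) := by
    intro x y hxy
    rw [hw x y hxy, alternates_iff w x y hxy]
    simp only [c]
    norm_cast
  have key : ∀ x, ∃ s : ℤ, G.Adj h x → ∀ t, 0 ≤ c x t - c h t + s ∧ c x t - c h t + s ≤ 1 := by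
    intro x
    by_cases hx : G.Adj h x
    · rcases (alt h x hx.ne).1 hx with h1 | h1
      · exact ⟨0, fun _ t => by have := h1 t; omega⟩
      · exact ⟨1, fun _ t => by have := h1 t; omega⟩
    · exact ⟨0, fun h => absurd h hx⟩
  choose s hs using key
  refine ⟨fun x t => c x t - c h t + s x, fun x y hx hy hxy => ?_⟩
  rw [alt x y hxy]
  have sx := hs x hx
  have sy := hs y hy
  simp only [Pi.le_def]
  constructor
  · rintro (h1 | h1)
    · by_cases k : s x ≤ s y
      · left; intro t; have := h1 t; omega
      · right; intro t; have := h1 t; omega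
    · by_cases k : s y ≤ s x
      · right; intro t; have := h1 t; omega
      · left; intro t; have := h1 t; omega
  · have ax := sx 0
    have ay := sy 0
    simp only [c0] at ax ay
    rintro (h1 | h1)
    · have a0 := h1 0
      simp only [c0] at a0
      by_cases k : s x = s y
      · left; intro t; have := h1 t; have := sx t; have := sy t; omega
      · right; intro t; have := h1 t; have := sx t; have := sy t; omega
    · have a0 := h1 0
      simp only [c0] at a0
      by_cases k : s x = s y
      · right; intro t; have := h1 t; have := sx t; have := sy t; omega
      · left; intro t; have := h1 t; have := sx t; have := sy t; omega

theorem flip_step {P : Type*} [Preorder P] {a b c : P} (h1 : a ≤ b ∨ b ≤ a) (h2 : b ≤ c ∨ c ≤ b)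
    (h3 : ¬ (a ≤ c ∨ c ≤ a)) : (a ≤ b ↔ ¬ b ≤ c) := by
  constructor
  · intro h h'; exact h3 (Or.inl (h.trans h'))
  · intro h
    rcases h1 with h1 | h1
    · exact h1
    · rcases h2 with h2 | h2
      · exact absurd h2 h
      · exact absurd (Or.inr (h2.trans h1)) h3

theorem odd5 (p q r s t : Prop) (h1 : p ↔ ¬ q) (h2 : q ↔ ¬ r) (h3 : r ↔ ¬ s) (h4 : s ↔ ¬ t)
    (h5 : t ↔ ¬ p) : False := by
  tauto

theorem odd7 (p q r s t u v : Prop) (h1 : p ↔ ¬ q) (h2 : q ↔ ¬ r) (h3 : r ↔ ¬ s) (h4 : s ↔ ¬ t)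
    (h5 : t ↔ ¬ u) (h6 : u ↔ ¬ v) (h7 : v ↔ ¬ p) : False := by
  tauto

theorem no_wheel5 {V : Type*} [DecidableEq V] (G : SimpleGraph V)
    (hG : WordRepresentable G) (h a b c d e : V)
    (ha : G.Adj h a) (hb : G.Adj h b) (hc : G.Adj h c) (hd : G.Adj h d) (he : G.Adj h e)
    (ab : G.Adj a b) (bc : G.Adj b c) (cd : G.Adj c d) (de : G.Adj d e) (ea : G.Adj e a)
    (ac : a ≠ c ∧ ¬ G.Adj a c) (bd : b ≠ d ∧ ¬ G.Adj b d) (ce : c ≠ e ∧ ¬ G.Adj c e)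
    (da : d ≠ a ∧ ¬ G.Adj d a) (eb : e ≠ b ∧ ¬ G.Adj e b) : False := by
  obtain ⟨f, hf⟩ := nbhd_comparability G hG h
  rw [hf _ _ ha hb ab.ne] at ab
  rw [hf _ _ hb hc bc.ne] at bc
  rw [hf _ _ hc hd cd.ne] at cd
  rw [hf _ _ hd he de.ne] at de
  rw [hf _ _ he ha ea.ne] at ea
  have s1 := flip_step ab bc (by rw [← hf _ _ ha hc ac.1]; exact ac.2)
  have s2 := flip_step bc cd (by rw [← hf _ _ hb hd bd.1]; exact bd.2)
  have s3 := flip_step cd de (by rw [← hf _ _ hc he ce.1]; exact ce.2)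
  have s4 := flip_step de ea (by rw [← hf _ _ hd ha da.1]; exact da.2)
  have s5 := flip_step ea ab (by rw [← hf _ _ he hb eb.1]; exact eb.2)
  exact odd5 _ _ _ _ _ s1 s2 s3 s4 s5

theorem no_wheel7 {V : Type*} [DecidableEq V] (G : SimpleGraph V)
    (hG : WordRepresentable G) (h a b c d e i j : V)
    (ha : G.Adj h a) (hb : G.Adj h b) (hc : G.Adj h c) (hd : G.Adj h d) (he : G.Adj h e)
    (hi : G.Adj h i) (hj : G.Adj h j)
    (ab : G.Adj a b) (bc : G.Adj b c) (cd : G.Adj c d) (de : G.Adj d e) (ei : G.Adj e i)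
    (ij : G.Adj i j) (ja : G.Adj j a)
    (ac : a ≠ c ∧ ¬ G.Adj a c) (bd : b ≠ d ∧ ¬ G.Adj b d) (ce : c ≠ e ∧ ¬ G.Adj c e)
    (di : d ≠ i ∧ ¬ G.Adj d i) (ej : e ≠ j ∧ ¬ G.Adj e j) (ia : i ≠ a ∧ ¬ G.Adj i a)
    (jb : j ≠ b ∧ ¬ G.Adj j b) : False := by
  obtain ⟨f, hf⟩ := nbhd_comparability G hG h
  rw [hf _ _ ha hb ab.ne] at ab
  rw [hf _ _ hb hc bc.ne] at bc
  rw [hf _ _ hc hd cd.ne] at cd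
  rw [hf _ _ hd he de.ne] at de
  rw [hf _ _ he hi ei.ne] at ei
  rw [hf _ _ hi hj ij.ne] at ij
  rw [hf _ _ hj ha ja.ne] at ja
  have s1 := flip_step ab bc (by rw [← hf _ _ ha hc ac.1]; exact ac.2)
  have s2 := flip_step bc cd (by rw [← hf _ _ hb hd bd.1]; exact bd.2)
  have s3 := flip_step cd de (by rw [← hf _ _ hc he ce.1]; exact ce.2)
  have s4 := flip_step de ei (by rw [← hf _ _ hd hi di.1]; exact di.2)
  have s5 := flip_step ei ij (by rw [← hf _ _ he hj ej.1]; exact ej.2)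
  have s6 := flip_step ij ja (by rw [← hf _ _ hi ha ia.1]; exact ia.2)
  have s7 := flip_step ja ab (by rw [← hf _ _ hj hb jb.1]; exact jb.2)
  exact odd7 _ _ _ _ _ _ _ s1 s2 s3 s4 s5 s6 s7

/-- Shape of adjacency. -/
theorem grid_adj (m n : ℕ) (diag : ℕ → ℕ → Bool) (a b c d : ℕ) (h h') :
    (gridTriangulation m n diag).Adj ⟨(a, b), h⟩ ⟨(c, d), h'⟩ ↔
      (c = a + 1 ∧ d = b) ∨ (a = c + 1 ∧ b = d) ∨ (c = a ∧ d = b + 1) ∨ (a = c ∧ b = d + 1) ∨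
      (diag a b = true ∧ c = a + 1 ∧ d = b + 1) ∨ (diag c d = true ∧ a = c + 1 ∧ b = d + 1) ∨
      (diag c b = false ∧ a = c + 1 ∧ d = b + 1) ∨ (diag a d = false ∧ c = a + 1 ∧ b = d + 1) := by
  unfold gridTriangulation
  simp only [SimpleGraph.fromRel_adj, ne_eq, Subtype.mk.injEq, Prod.mk.injEq]
  constructor
  · rintro ⟨h0, (h | h | h | ⟨i, j, h1, h2, h3, h4, h5⟩) | (h | h | h | ⟨i, j, h1, h2, h3, h4, h5⟩)⟩
    · tauto
    · tauto
    · tauto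
    · subst h2 h3 h4 h5; simp [h1]
    · tauto
    · tauto
    · tauto
    · subst h2 h3 h4 h5; simp [h1]
  · rintro (h | h | h | h | h | h | h | h)
    · exact ⟨by omega, by tauto⟩
    · exact ⟨by omega, by tauto⟩
    · exact ⟨by omega, by tauto⟩
    · exact ⟨by omega, by tauto⟩
    · exact ⟨by omega, by tauto⟩
    · exact ⟨by omega, by tauto⟩
    · exact ⟨by omega, Or.inl (Or.inr (Or.inr (Or.inr ⟨c, b, h.1, h.2.1, rfl, rfl, h.2.2⟩)))⟩
    · exact ⟨by omega, Or.inr (Or.inr (Or.inr (Or.inr ⟨a, d, h.1, h.2.1, rfl, rfl, h.2.2⟩)))⟩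

theorem parity (m n : ℕ) (diag : ℕ → ℕ → Bool)
    (hG : WordRepresentable (gridTriangulation m n diag)) (i j : ℕ) (hi : i + 2 ≤ m)
    (hj : j + 2 ≤ n) :
    diag (i+1) (j+1) = (diag i j ^^ diag (i+1) j ^^ diag i (j+1)) := by
  let v : ∀ a b : ℕ, a ≤ 2 → b ≤ 2 → GridV m n :=
    fun a b ha hb => ⟨(i + a, j + b), by simp only; omega⟩
  let C := v 1 1 (by omega) (by omega)
  let N := v 1 2 (by omega) (by omega)
  let S := v 1 0 (by omega) (by omega)
  let E := v 2 1 (by omega) (by omega)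
  let W := v 0 1 (by omega) (by omega)
  let NE := v 2 2 (by omega) (by omega)
  let NW := v 0 2 (by omega) (by omega)
  let SE := v 2 0 (by omega) (by omega)
  let SW := v 0 0 (by omega) (by omega)
  cases h1 : diag i j <;> cases h2 : diag (i+1) j <;> cases h3 : diag i (j+1) <;>
    cases h4 : diag (i+1) (j+1) <;> first | rfl | exfalso
  · refine no_wheel7 _ hG C N NE E SE S W NW ?_ ?_ ?_ ?_ ?_ ?_ ?_ ?_ ?_ ?_ ?_ ?_ ?_ ?_ ?_ ?_ ?_ ?_ ?_ ?_ ?_ <;>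
      simp [C, N, S, E, W, NE, NW, SE, SW, v, grid_adj, h1, h2, h3, h4] <;> omega
  · refine no_wheel5 _ hG C N E SE S W ?_ ?_ ?_ ?_ ?_ ?_ ?_ ?_ ?_ ?_ ?_ ?_ ?_ ?_ ?_ <;>
      simp [C, N, S, E, W, NE, NW, SE, SW, v, grid_adj, h1, h2, h3, h4] <;> omega
  · refine no_wheel5 _ hG C N E S W NW ?_ ?_ ?_ ?_ ?_ ?_ ?_ ?_ ?_ ?_ ?_ ?_ ?_ ?_ ?_ <;>
      simp [C, N, S, E, W, NE, NW, SE, SW, v, grid_adj, h1, h2, h3, h4] <;> omega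
  · refine no_wheel5 _ hG C N NE E S W ?_ ?_ ?_ ?_ ?_ ?_ ?_ ?_ ?_ ?_ ?_ ?_ ?_ ?_ ?_ <;>
      simp [C, N, S, E, W, NE, NW, SE, SW, v, grid_adj, h1, h2, h3, h4] <;> omega
  · refine no_wheel7 _ hG C N E SE S SW W NW ?_ ?_ ?_ ?_ ?_ ?_ ?_ ?_ ?_ ?_ ?_ ?_ ?_ ?_ ?_ ?_ ?_ ?_ ?_ ?_ ?_ <;>
      simp [C, N, S, E, W, NE, NW, SE, SW, v, grid_adj, h1, h2, h3, h4] <;> omega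
  · refine no_wheel7 _ hG C N NE E SE S SW W ?_ ?_ ?_ ?_ ?_ ?_ ?_ ?_ ?_ ?_ ?_ ?_ ?_ ?_ ?_ ?_ ?_ ?_ ?_ ?_ ?_ <;>
      simp [C, N, S, E, W, NE, NW, SE, SW, v, grid_adj, h1, h2, h3, h4] <;> omega
  · refine no_wheel7 _ hG C N NE E S SW W NW ?_ ?_ ?_ ?_ ?_ ?_ ?_ ?_ ?_ ?_ ?_ ?_ ?_ ?_ ?_ ?_ ?_ ?_ ?_ ?_ ?_ <;>
      simp [C, N, S, E, W, NE, NW, SE, SW, v, grid_adj, h1, h2, h3, h4] <;> omega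
  · refine no_wheel5 _ hG C N E S SW W ?_ ?_ ?_ ?_ ?_ ?_ ?_ ?_ ?_ ?_ ?_ ?_ ?_ ?_ ?_ <;>
      simp [C, N, S, E, W, NE, NW, SE, SW, v, grid_adj, h1, h2, h3, h4] <;> omega

def walkSum (f : ℕ → Bool) : ℕ → Fin 3
  | 0 => 0
  | k + 1 => walkSum f k + (if f k then 1 else 2)

theorem colorable_of_parity (m n : ℕ) (diag : ℕ → ℕ → Bool)
    (hp : ∀ i j, i + 2 ≤ m → j + 2 ≤ n →
      diag (i+1) (j+1) = (diag i j ^^ diag (i+1) j ^^ diag i (j+1))) :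
    (gridTriangulation m n diag).Colorable 3 := by
  have hd : ∀ i j, i < m → j < n → diag i j = (diag i 0 ^^ diag 0 j ^^ diag 0 0) := by
    intro i
    induction i with
    | zero => intro j _ _; cases diag 0 0 <;> cases diag 0 j <;> rfl
    | succ i ih =>
      intro j
      induction j with
      | zero => intro _ _; cases diag 0 0 <;> cases diag (i+1) 0 <;> rfl
      | succ j jh =>
        intro h1 h2
        rw [hp i j (by omega) (by omega), jh (by omega) (by omega), ih j (by omega) (by omega),
          ih (j+1) (by omega) (by omega)]
        cases diag 0 0 <;> cases diag (i+1) 0 <;> cases diag i 0 <;> cases diag 0 j <;>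
          cases diag 0 (j+1) <;> rfl
  let A := walkSum fun x => diag x 0
  let B := walkSum fun y => !(diag 0 y ^^ diag 0 0)
  have hA : ∀ x, A (x+1) = A x + (if diag x 0 then 1 else 2) := fun x => rfl
  have hB : ∀ y, B (y+1) = B y + (if !(diag 0 y ^^ diag 0 0) then 1 else 2) := fun y => rfl
  have f1 : ∀ (a b : Fin 3) (p : Bool), a + (if p then 1 else 2) + b ≠ a + b := by decide
  have f2 : ∀ (a b : Fin 3) (p : Bool), a + (b + (if p then 1 else 2)) ≠ a + b := by decide
  have f3 : ∀ (a b : Fin 3) (p q : Bool), (p ^^ q) = true →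
    a + (if p then 1 else 2) + (b + (if !q then 1 else 2)) ≠ a + b := by decide
  have f4 : ∀ (a b : Fin 3) (p q : Bool), (p ^^ q) = false →
    a + (if p then 1 else 2) + b ≠ a + (b + (if !q then 1 else 2)) := by decide
  refine ⟨SimpleGraph.Coloring.mk (fun v => A v.1.1 + B v.1.2) ?_⟩
  rintro ⟨⟨a, b⟩, h⟩ ⟨⟨c, d⟩, h'⟩ hadj
  rw [grid_adj] at hadj
  simp only at h h' ⊢
  rcases hadj with ⟨rfl, rfl⟩ | ⟨rfl, rfl⟩ | ⟨rfl, rfl⟩ | ⟨rfl, rfl⟩ | ⟨e, rfl, rfl⟩ |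
    ⟨e, rfl, rfl⟩ | ⟨e, rfl, rfl⟩ | ⟨e, rfl, rfl⟩
  · rw [hA]; exact (f1 _ _ _).symm
  · rw [hA]; exact (f1 _ _ _)
  · rw [hB]; exact (f2 _ _ _).symm
  · rw [hB]; exact (f2 _ _ _)
  · rw [hd _ _ (by omega) (by omega), Bool.xor_assoc] at e
    rw [hA, hB]; exact (f3 _ _ _ _ e).symm
  · rw [hd _ _ (by omega) (by omega), Bool.xor_assoc] at e
    rw [hA, hB]; exact (f3 _ _ _ _ e)
  · rw [hd _ _ (by omega) (by omega), Bool.xor_assoc] at e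
    rw [hA, hB]; exact (f4 _ _ _ _ e)
  · rw [hd _ _ (by omega) (by omega), Bool.xor_assoc] at e
    rw [hA, hB]; exact (f4 _ _ _ _ e).symm

/-- A word in which every edge reads `xyxy...xy` along the orientation by colours. -/
def GoodWord {V : Type*} [DecidableEq V] (G : SimpleGraph V) (c : V → ℕ) (w : List V) : Prop :=
  ∀ x y, G.Adj x y → c x < c y →
    ∃ k, (w.filter fun z => z = x ∨ z = y) = (List.replicate k [x, y]).flatten

theorem GoodWord.append {V : Type*} [DecidableEq V] {G : SimpleGraph V} {c : V → ℕ}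
    {w w' : List V} (h : GoodWord G c w) (h' : GoodWord G c w') : GoodWord G c (w ++ w') := by
  intro x y hxy hc
  obtain ⟨k, hk⟩ := h x y hxy hc
  obtain ⟨l, hl⟩ := h' x y hxy hc
  exact ⟨k + l, by rw [List.filter_append, hk, hl, List.replicate_add, List.flatten_append]⟩

theorem GoodWord.flatten {V : Type*} [DecidableEq V] {G : SimpleGraph V} {c : V → ℕ}
    (L : List (List V)) (h : ∀ w ∈ L, GoodWord G c w) : GoodWord G c L.flatten := by
  induction L with
  | nil => intro x y _ _; exact ⟨0, by simp⟩
  | cons a L ih =>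
    rw [List.flatten_cons]
    exact (h a (by simp)).append (ih fun w hw => h w (by simp [hw]))

theorem isChain_rep {V : Type*} (x y : V) (h : x ≠ y) (k : ℕ) :
    List.IsChain (· ≠ ·) (List.replicate k [x, y]).flatten := by
  induction k with
  | zero => simp
  | succ k ih =>
    cases k with
    | zero => simp [h]
    | succ k =>
      simp only [List.replicate_succ, List.flatten_cons, List.cons_append, List.nil_append,
        List.isChain_cons_cons] at ih ⊢
      exact ⟨h, h.symm, ih⟩

theorem GoodWord.alternates {V : Type*} [DecidableEq V] {G : SimpleGraph V} {c : V → ℕ}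
    {w : List V} (h : GoodWord G c w) (hc : ∀ x y, G.Adj x y → c x ≠ c y) (x y : V)
    (hxy : G.Adj x y) : Alternates w x y := by
  have key : ∀ x y, G.Adj x y → c x < c y → Alternates w x y := by
    intro x y hxy hlt
    obtain ⟨k, hk⟩ := h x y hxy hlt
    change List.IsChain _ _
    rw [hk]
    exact isChain_rep x y hxy.ne k
  rcases lt_or_gt_of_ne (hc x y hxy) with h1 | h1
  · exact key x y hxy h1
  · exact (alternates_comm _ _ _).1 (key y x hxy.symm h1)

theorem filter_pair {V : Type*} [DecidableEq V] (L : List V) (hL : L.Nodup) (hm : ∀ v, v ∈ L)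
    (x y : V) (P : V → Prop) [DecidablePred P] (h : ¬ (P x ∧ P y)) :
    ((L.filter fun z => P z).filter fun z => z = x ∨ z = y) =
      (if P x then [x] else []) ++ (if P y then [y] else []) := by
  rw [List.filter_filter]
  have gen : ∀ a, P a → (∀ z, (P z ∧ (z = x ∨ z = y)) ↔ z = a) →
      (L.filter fun z => decide (z = x ∨ z = y) && decide (P z)) = [a] := by
    intro a _ ha
    have : (L.filter fun z => decide (z = x ∨ z = y) && decide (P z)) = L.filter (· == a) := by
      apply List.filter_congr
      intro z _
      rw [Bool.eq_iff_iff]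
      simp only [Bool.and_eq_true, decide_eq_true_eq, beq_iff_eq]
      rw [← ha z]; tauto
    rw [this, List.filter_beq, List.count_eq_one_of_mem hL (hm a)]
    rfl
  by_cases hx : P x
  · have hy : ¬ P y := fun hy => h ⟨hx, hy⟩
    rw [if_pos hx, if_neg hy, List.append_nil]
    refine gen x hx fun z => ⟨?_, ?_⟩
    · rintro ⟨hz, rfl | rfl⟩
      · rfl
      · exact absurd hz hy
    · rintro rfl; exact ⟨hx, Or.inl rfl⟩
  · by_cases hy : P y
    · rw [if_neg hx, if_pos hy, List.nil_append]
      refine gen y hy fun z => ⟨?_, ?_⟩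
      · rintro ⟨hz, rfl | rfl⟩
        · exact absurd hz hx
        · rfl
      · rintro rfl; exact ⟨hy, Or.inr rfl⟩
    · rw [if_neg hx, if_neg hy, List.append_nil, List.filter_eq_nil_iff]
      intro z _
      simp only [Bool.and_eq_true, decide_eq_true_eq]
      rintro ⟨rfl | rfl, hz⟩
      · exact hx hz
      · exact hy hz

set_option maxHeartbeats 2000000 in
theorem bad_pair {V : Type*} [DecidableEq V] (G : SimpleGraph V) (c : V → ℕ)
    (hc3 : ∀ v, c v < 3)
    (L : List V) (hL : L.Nodup) (hm : ∀ v, v ∈ L) (u v : V) (huv : u ≠ v) (hadj : ¬ G.Adj u v)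
    (hle : c u ≤ c v) :
    ∃ w, GoodWord G c w ∧ ¬ Alternates w u v := by
  have hadj' : ¬ G.Adj v u := fun h => hadj h.symm
  have h3 : ∀ v, c v = 0 ∨ c v = 1 ∨ c v = 2 := fun v => by have := hc3 v; omega
  let A (i : ℕ) : List V := L.filter fun z => c z = i
  let A' (i : ℕ) (a : V) : List V := L.filter fun z => c z = i ∧ z ≠ a
  have fA : ∀ i x y, ¬ (c x = i ∧ c y = i) → ((A i).filter fun z => z = x ∨ z = y) =
      (if c x = i then [x] else []) ++ (if c y = i then [y] else []) :=
    fun i x y h => filter_pair L hL hm x y (fun z => c z = i) h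
  have fA' : ∀ i a x y, ¬ ((c x = i ∧ x ≠ a) ∧ (c y = i ∧ y ≠ a)) →
      ((A' i a).filter fun z => z = x ∨ z = y) =
      (if c x = i ∧ x ≠ a then [x] else []) ++ (if c y = i ∧ y ≠ a then [y] else []) :=
    fun i a x y h => filter_pair L hL hm x y (fun z => c z = i ∧ z ≠ a) h
  have hcc : ∀ x y, c x < c y →
      (c x = 0 ∧ c y = 1) ∨ (c x = 0 ∧ c y = 2) ∨ (c x = 1 ∧ c y = 2) := by
    intro x y h; have := h3 x; have := h3 y; omega
  have gA : ∀ i, i ≠ c u ∨ i ≠ c v → ((A i).filter fun z => z = u ∨ z = v) =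
      (if c u = i then [u] else []) ++ (if c v = i then [v] else []) :=
    fun i h => fA i u v (by omega)
  have gu : ∀ i, ((A' i u).filter fun z => z = u ∨ z = v) = (if c v = i then [v] else []) := by
    intro i
    rw [fA' i u u v (by simp)]
    simp [huv.symm]
  have gv : ∀ i, ((A' i v).filter fun z => z = u ∨ z = v) = (if c u = i then [u] else []) := by
    intro i
    rw [fA' i v u v (by simp)]
    simp [huv]
  have cases6 : (c u = 0 ∧ c v = 0) ∨ (c u = 0 ∧ c v = 1) ∨ (c u = 0 ∧ c v = 2) ∨
      (c u = 1 ∧ c v = 1) ∨ (c u = 1 ∧ c v = 2) ∨ (c u = 2 ∧ c v = 2) := by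
    have := h3 u; have := h3 v; omega
  clear_value A A'
  obtain ⟨eu, ev⟩ | ⟨eu, ev⟩ | ⟨eu, ev⟩ | ⟨eu, ev⟩ | ⟨eu, ev⟩ | ⟨eu, ev⟩ := cases6
  · refine ⟨A' 0 u ++ [u] ++ A 1 ++ A 2 ++ ([u] ++ A' 0 u ++ A 1 ++ A 2), ?_, ?_⟩
    · intro x y hxy hlt
      have n1 : ∀ i, ¬ (c x = i ∧ c y = i) := by intro i; omega
      have n2 : ∀ i a, ¬ ((c x = i ∧ x ≠ a) ∧ (c y = i ∧ y ≠ a)) := by intro i a; omega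
      refine ⟨2, ?_⟩
      simp only [List.filter_append, fA _ _ _ (n1 _), fA' _ _ _ _ (n2 _ _)]
      obtain ⟨ex, ey⟩ | ⟨ex, ey⟩ | ⟨ex, ey⟩ := hcc x y hlt <;>
        by_cases q1 : x = u <;> by_cases q2 : y = u <;> by_cases q3 : x = v <;>
        by_cases q4 : y = v <;>
        first
        | (exfalso; grind)
        | (simp [List.filter_cons, List.replicate_succ, ex, ey, eu, ev, q1, q2, q3, q4,
             huv, huv.symm, eq_comm (a := u) (b := x), eq_comm (a := u) (b := y),
             eq_comm (a := v) (b := x), eq_comm (a := v) (b := y)])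
        | (subst_vars
           simp_all [List.filter_cons, List.replicate_succ])
    · intro h
      change List.IsChain _ _ at h
      simp [List.filter_append, List.filter_cons, gA, gu, gv, eu, ev, huv, huv.symm, -Bool.decide_or] at h
  · refine ⟨A 0 ++ A 1 ++ A 2 ++ (A' 0 u ++ [v] ++ [u] ++ A' 1 v ++ A 2), ?_, ?_⟩
    · intro x y hxy hlt
      have n1 : ∀ i, ¬ (c x = i ∧ c y = i) := by intro i; omega
      have n2 : ∀ i a, ¬ ((c x = i ∧ x ≠ a) ∧ (c y = i ∧ y ≠ a)) := by intro i a; omega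
      refine ⟨2, ?_⟩
      simp only [List.filter_append, fA _ _ _ (n1 _), fA' _ _ _ _ (n2 _ _)]
      obtain ⟨ex, ey⟩ | ⟨ex, ey⟩ | ⟨ex, ey⟩ := hcc x y hlt <;>
        by_cases q1 : x = u <;> by_cases q2 : y = u <;> by_cases q3 : x = v <;>
        by_cases q4 : y = v <;>
        first
        | (exfalso; grind)
        | (simp [List.filter_cons, List.replicate_succ, ex, ey, eu, ev, q1, q2, q3, q4,
             huv, huv.symm, eq_comm (a := u) (b := x), eq_comm (a := u) (b := y),
             eq_comm (a := v) (b := x), eq_comm (a := v) (b := y)])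
        | (subst_vars
           simp_all [List.filter_cons, List.replicate_succ])
    · intro h
      change List.IsChain _ _ at h
      simp [List.filter_append, List.filter_cons, gA, gu, gv, eu, ev, huv, huv.symm, -Bool.decide_or] at h
  · refine ⟨A 0 ++ A 1 ++ A' 2 v ++ [u] ++ [v] ++ A' 0 u ++ A 1 ++ A 2, ?_, ?_⟩
    · intro x y hxy hlt
      have n1 : ∀ i, ¬ (c x = i ∧ c y = i) := by intro i; omega
      have n2 : ∀ i a, ¬ ((c x = i ∧ x ≠ a) ∧ (c y = i ∧ y ≠ a)) := by intro i a; omega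
      refine ⟨2, ?_⟩
      simp only [List.filter_append, fA _ _ _ (n1 _), fA' _ _ _ _ (n2 _ _)]
      obtain ⟨ex, ey⟩ | ⟨ex, ey⟩ | ⟨ex, ey⟩ := hcc x y hlt <;>
        by_cases q1 : x = u <;> by_cases q2 : y = u <;> by_cases q3 : x = v <;>
        by_cases q4 : y = v <;>
        first
        | (exfalso; grind)
        | (simp [List.filter_cons, List.replicate_succ, ex, ey, eu, ev, q1, q2, q3, q4,
             huv, huv.symm, eq_comm (a := u) (b := x), eq_comm (a := u) (b := y),
             eq_comm (a := v) (b := x), eq_comm (a := v) (b := y)])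
        | (subst_vars
           simp_all [List.filter_cons, List.replicate_succ])
    · intro h
      change List.IsChain _ _ at h
      simp [List.filter_append, List.filter_cons, gA, gu, gv, eu, ev, huv, huv.symm, -Bool.decide_or] at h
  · refine ⟨A 0 ++ A' 1 u ++ [u] ++ A 2 ++ (A 0 ++ [u] ++ A' 1 u ++ A 2), ?_, ?_⟩
    · intro x y hxy hlt
      have n1 : ∀ i, ¬ (c x = i ∧ c y = i) := by intro i; omega
      have n2 : ∀ i a, ¬ ((c x = i ∧ x ≠ a) ∧ (c y = i ∧ y ≠ a)) := by intro i a; omega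
      refine ⟨2, ?_⟩
      simp only [List.filter_append, fA _ _ _ (n1 _), fA' _ _ _ _ (n2 _ _)]
      obtain ⟨ex, ey⟩ | ⟨ex, ey⟩ | ⟨ex, ey⟩ := hcc x y hlt <;>
        by_cases q1 : x = u <;> by_cases q2 : y = u <;> by_cases q3 : x = v <;>
        by_cases q4 : y = v <;>
        first
        | (exfalso; grind)
        | (simp [List.filter_cons, List.replicate_succ, ex, ey, eu, ev, q1, q2, q3, q4,
             huv, huv.symm, eq_comm (a := u) (b := x), eq_comm (a := u) (b := y),
             eq_comm (a := v) (b := x), eq_comm (a := v) (b := y)])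
        | (subst_vars
           simp_all [List.filter_cons, List.replicate_succ])
    · intro h
      change List.IsChain _ _ at h
      simp [List.filter_append, List.filter_cons, gA, gu, gv, eu, ev, huv, huv.symm, -Bool.decide_or] at h
  · refine ⟨A 0 ++ A 1 ++ A 2 ++ (A 0 ++ A' 1 u ++ [v] ++ [u] ++ A' 2 v), ?_, ?_⟩
    · intro x y hxy hlt
      have n1 : ∀ i, ¬ (c x = i ∧ c y = i) := by intro i; omega
      have n2 : ∀ i a, ¬ ((c x = i ∧ x ≠ a) ∧ (c y = i ∧ y ≠ a)) := by intro i a; omega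
      refine ⟨2, ?_⟩
      simp only [List.filter_append, fA _ _ _ (n1 _), fA' _ _ _ _ (n2 _ _)]
      obtain ⟨ex, ey⟩ | ⟨ex, ey⟩ | ⟨ex, ey⟩ := hcc x y hlt <;>
        by_cases q1 : x = u <;> by_cases q2 : y = u <;> by_cases q3 : x = v <;>
        by_cases q4 : y = v <;>
        first
        | (exfalso; grind)
        | (simp [List.filter_cons, List.replicate_succ, ex, ey, eu, ev, q1, q2, q3, q4,
             huv, huv.symm, eq_comm (a := u) (b := x), eq_comm (a := u) (b := y),
             eq_comm (a := v) (b := x), eq_comm (a := v) (b := y)])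
        | (subst_vars
           simp_all [List.filter_cons, List.replicate_succ])
    · intro h
      change List.IsChain _ _ at h
      simp [List.filter_append, List.filter_cons, gA, gu, gv, eu, ev, huv, huv.symm, -Bool.decide_or] at h
  · refine ⟨A 0 ++ A 1 ++ A' 2 u ++ [u] ++ (A 0 ++ A 1 ++ [u] ++ A' 2 u), ?_, ?_⟩
    · intro x y hxy hlt
      have n1 : ∀ i, ¬ (c x = i ∧ c y = i) := by intro i; omega
      have n2 : ∀ i a, ¬ ((c x = i ∧ x ≠ a) ∧ (c y = i ∧ y ≠ a)) := by intro i a; omega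
      refine ⟨2, ?_⟩
      simp only [List.filter_append, fA _ _ _ (n1 _), fA' _ _ _ _ (n2 _ _)]
      obtain ⟨ex, ey⟩ | ⟨ex, ey⟩ | ⟨ex, ey⟩ := hcc x y hlt <;>
        by_cases q1 : x = u <;> by_cases q2 : y = u <;> by_cases q3 : x = v <;>
        by_cases q4 : y = v <;>
        first
        | (exfalso; grind)
        | (simp [List.filter_cons, List.replicate_succ, ex, ey, eu, ev, q1, q2, q3, q4,
             huv, huv.symm, eq_comm (a := u) (b := x), eq_comm (a := u) (b := y),
             eq_comm (a := v) (b := x), eq_comm (a := v) (b := y)])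
        | (subst_vars
           simp_all [List.filter_cons, List.replicate_succ])
    · intro h
      change List.IsChain _ _ at h
      simp [List.filter_append, List.filter_cons, gA, gu, gv, eu, ev, huv, huv.symm, -Bool.decide_or] at h

theorem wordRepresentable_of_colorable {V : Type*} [Fintype V] [DecidableEq V]
    (G : SimpleGraph V) (h : G.Colorable 3) : WordRepresentable G := by
  obtain ⟨C⟩ := h
  let c : V → ℕ := fun v => (C v).val
  have hc : ∀ x y, G.Adj x y → c x ≠ c y := fun x y hxy h => C.valid hxy (Fin.ext h)
  have hL := Finset.nodup_toList (Finset.univ : Finset V)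
  have hm : ∀ v : V, v ∈ (Finset.univ : Finset V).toList := by simp
  have bad : ∀ p : V × V, ∃ w, GoodWord G c w ∧
      (p.1 ≠ p.2 → ¬ G.Adj p.1 p.2 → ¬ Alternates w p.1 p.2) := by
    rintro ⟨u, v⟩
    by_cases h : u ≠ v ∧ ¬ G.Adj u v
    · rcases le_total (c u) (c v) with h1 | h1
      · obtain ⟨w, h2, h3⟩ := bad_pair G c (fun v => (C v).isLt) _ hL hm u v h.1 h.2 h1
        exact ⟨w, h2, fun _ _ => h3⟩
      · obtain ⟨w, h2, h3⟩ := bad_pair G c (fun v => (C v).isLt) _ hL hm v u h.1.symm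
          (fun h' => h.2 h'.symm) h1
        exact ⟨w, h2, fun _ _ h4 => h3 ((alternates_comm _ _ _).1 h4)⟩
    · exact ⟨[], fun x y _ _ => ⟨0, by simp⟩, fun h1 h2 => absurd ⟨h1, h2⟩ h⟩
  choose w hw1 hw2 using bad
  let L := (Finset.univ : Finset V).toList
  let W0 : List V := (L.filter fun z => c z = 0) ++ (L.filter fun z => c z = 1) ++
    (L.filter fun z => c z = 2)
  have hW0 : GoodWord G c W0 := by
    intro x y hxy hlt
    have h1 := (C x).isLt
    have h2 := (C y).isLt
    refine ⟨1, ?_⟩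
    simp only [W0, List.filter_append]
    rw [filter_pair L hL hm x y (fun z => c z = 0) (by omega),
      filter_pair L hL hm x y (fun z => c z = 1) (by omega),
      filter_pair L hL hm x y (fun z => c z = 2) (by omega)]
    have : (c x = 0 ∧ c y = 1) ∨ (c x = 0 ∧ c y = 2) ∨ (c x = 1 ∧ c y = 2) := by
      simp only [c] at hlt ⊢; omega
    rcases this with ⟨e1, e2⟩ | ⟨e1, e2⟩ | ⟨e1, e2⟩ <;> simp [e1, e2]
  let LL := ((Finset.univ : Finset (V × V)).toList.map w)
  have hLL : GoodWord G c LL.flatten := by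
    apply GoodWord.flatten
    intro a ha
    obtain ⟨p, -, rfl⟩ := List.mem_map.1 ha
    exact hw1 p
  refine ⟨W0 ++ LL.flatten, ?_, ?_⟩
  · intro v
    have : c v < 3 := (C v).isLt
    have : c v = 0 ∨ c v = 1 ∨ c v = 2 := by omega
    simp only [W0, List.mem_append, List.mem_filter, L, hm]
    left
    rcases this with e | e | e <;> simp [e]
  · intro x y hxy
    constructor
    · intro h
      exact (hW0.append hLL).alternates hc x y h
    · intro h
      by_contra hn
      refine hw2 (x, y) hxy hn ?_
      have hi : w (x, y) <:+: W0 ++ LL.flatten := by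
        have : w (x, y) ∈ LL := List.mem_map.2 ⟨(x, y), by simp, rfl⟩
        obtain ⟨s, t, e⟩ := List.append_of_mem this
        rw [e]
        exact ⟨W0 ++ s.flatten, t.flatten, by simp⟩
      exact List.IsChain.infix h (hi.filter _)

theorem gridTriangulation_wordRepresentable_iff_colorable :
    ∀ (m n : ℕ), 1 ≤ m → 1 ≤ n → ∀ diag : ℕ → ℕ → Bool,
      (WordRepresentable (gridTriangulation m n diag) ↔
        (gridTriangulation m n diag).Colorable 3) := by
  intro m n _ _ diag
  constructor
  · intro h
    exact colorable_of_parity m n diag fun i j hi hj => parity m n diag h i j hi hj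
  · intro h
    have : Finite (GridV m n) := by
      apply Set.Finite.subset ((Set.finite_Iic m).prod (Set.finite_Iic n))
      rintro ⟨a, b⟩ h
      exact h
    have := Fintype.ofFinite (GridV m n)
    exact wordRepresentable_of_colorable _ h
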